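/- arXiv:2208.04030 — 3 statements merged into one kernel-verified Lean document; each statement's English description precedes it below -/
import Mathlib

section
/- Let κ_v, a_v, σ_v > 0 and θ_v ≥ 0, and define g_V(s,u,x) = θ_v·s·1_{(0,∞)}(s) + σ_v·u·√x·1_{(0,∞)}(x) for (s,u,x) ∈ ℝ³. Then there exists a constant C > 0 such that for all x, y ∈ ℝ one has ∫_{ℝ²} (g_V(s,u,x) − g_V(s,u,y))² dν₁(s,u) ≤ C|x − y|. (This is the square-root Hölder-type estimate used in the Yamada–Watanabe pathwise-uniqueness argument.) -/
open MeasureTheory Real Set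

/-- The Gamma Lévy density `g_γ(s) = (α/s)·e^{−βs}` for `s > 0`, `0` otherwise. -/
noncomputable def gGamma (α β : ℝ) (s : ℝ) : ℝ :=
  if 0 < s then (α / s) * Real.exp (-β * s) else 0

/-- The one-dimensional heat kernel `p₁(s,u) = (2πs)^{−1/2}·e^{−u²/(2s)}` for `s > 0`. -/
noncomputable def p1 (s u : ℝ) : ℝ :=
  if 0 < s then (Real.sqrt (2 * Real.pi * s))⁻¹ * Real.exp (-(u ^ 2) / (2 * s)) else 0

/-- The measure `ν₁` on `ℝ²` with density `(s,u) ↦ g_γ(s)·p₁(s,u)` w.r.t. Lebesgue measure. -/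
noncomputable def nu1 (α β : ℝ) : Measure (ℝ × ℝ) :=
  (volume : Measure (ℝ × ℝ)).withDensity fun q => ENNReal.ofReal (gGamma α β q.1 * p1 q.1 q.2)

/-- The indicator function `1_{(0,∞)}`. -/
noncomputable def indPos (x : ℝ) : ℝ := if 0 < x then 1 else 0

/-- The jump coefficient of the variance equation:
`g_V(s,u,x) = θ_v·s·1_{(0,∞)}(s) + σ_v·u·√x·1_{(0,∞)}(x)`. -/
noncomputable def gV (θv σv : ℝ) (s u x : ℝ) : ℝ :=
  θv * s * indPos s + σv * u * Real.sqrt x * indPos x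

lemma measurable_gGamma (α β : ℝ) : Measurable (gGamma α β) := by
  unfold gGamma
  exact Measurable.ite measurableSet_Ioi (by fun_prop) measurable_const

lemma measurable_uncurry_p1 : Measurable fun q : ℝ × ℝ => p1 q.1 q.2 := by
  unfold p1
  exact Measurable.ite (measurableSet_lt measurable_const measurable_fst)
    (by fun_prop) measurable_const

lemma gGamma_nonneg {α : ℝ} (hα : 0 ≤ α) (β s : ℝ) : 0 ≤ gGamma α β s := by
  unfold gGamma
  split_ifs <;> positivity

/-- The second moment of the heat kernel at time `s` is `s`. -/
lemma lintegral_sq_mul_p1 {s : ℝ} (hs : 0 < s) :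
    ∫⁻ u, ENNReal.ofReal (p1 s u) * ENNReal.ofReal (u ^ 2) = ENNReal.ofReal s := by
  have hv : s.toNNReal ≠ 0 := by simpa using hs
  have hvar := ProbabilityTheory.ofReal_variance
    (ProbabilityTheory.memLp_id_gaussianReal (μ := 0) (v := s.toNNReal) 2)
  rw [ProbabilityTheory.variance_id_gaussianReal, ProbabilityTheory.evariance,
    ProbabilityTheory.gaussianReal_of_var_ne_zero 0 hv,
    lintegral_withDensity_eq_lintegral_mul _ (ProbabilityTheory.measurable_gaussianPDF _ _)
      (by fun_prop), ← ProbabilityTheory.gaussianReal_of_var_ne_zero 0 hv] at hvar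
  simp only [id, ProbabilityTheory.integral_id_gaussianReal, sub_zero,
    Real.coe_toNNReal s hs.le] at hvar
  rw [hvar]
  refine lintegral_congr fun u => ?_
  have hsq : ‖u‖ₑ ^ 2 = ENNReal.ofReal (u ^ 2) := by
    rw [Real.enorm_eq_ofReal_abs, ← ENNReal.ofReal_pow (abs_nonneg u), sq_abs]
  simp [p1, hs, hs.le, ProbabilityTheory.gaussianPDF, ProbabilityTheory.gaussianPDFReal, hsq]

lemma lintegral_gGamma_mul_id_lt_top (α : ℝ) {β : ℝ} (hβ : 0 < β) :
    ∫⁻ s, ENNReal.ofReal (gGamma α β s) * ENNReal.ofReal s < ⊤ := by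
  have hint : IntegrableOn (fun s => α * Real.exp (-β * s)) (Ioi 0) :=
    (exp_neg_integrableOn_Ioi 0 hβ).const_mul α
  refine lt_of_le_of_lt ?_ hint.lintegral_lt_top
  rw [← lintegral_indicator measurableSet_Ioi]
  refine lintegral_mono fun s => ?_
  by_cases hs : 0 < s
  · rw [indicator_of_mem (mem_Ioi.mpr hs), ← ENNReal.ofReal_mul' hs.le]
    refine ENNReal.ofReal_le_ofReal (le_of_eq ?_)
    simp only [gGamma, hs, if_true]
    field_simp
  · simp [gGamma, hs]

/-- The measure `ν₁` has finite second moment in its second variable. -/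
lemma lintegral_snd_sq_nu1_lt_top {α β : ℝ} (hα : 0 ≤ α) (hβ : 0 < β) :
    ∫⁻ q : ℝ × ℝ, ENNReal.ofReal (q.2 ^ 2) ∂nu1 α β < ⊤ := by
  have hg : Measurable fun q : ℝ × ℝ => gGamma α β q.1 :=
    (measurable_gGamma α β).comp measurable_fst
  have hd : Measurable fun q : ℝ × ℝ => ENNReal.ofReal (gGamma α β q.1 * p1 q.1 q.2) :=
    (hg.mul measurable_uncurry_p1).ennreal_ofReal
  rw [nu1, lintegral_withDensity_eq_lintegral_mul _ hd (by fun_prop), Measure.volume_eq_prod,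
    lintegral_prod _ (hd.mul (by fun_prop)).aemeasurable]
  refine lt_of_le_of_lt (lintegral_mono fun s => ?_) (lintegral_gGamma_mul_id_lt_top α hβ)
  by_cases hs : 0 < s
  · simp only [Pi.mul_apply, ENNReal.ofReal_mul (gGamma_nonneg hα β s), mul_assoc]
    rw [lintegral_const_mul' _ _ ENNReal.ofReal_ne_top, lintegral_sq_mul_p1 hs]
  · simp [gGamma, hs]

lemma sq_sqrt_sub_sqrt_le (x y : ℝ) : (√x - √y) ^ 2 ≤ |x - y| := by
  wlog hxy : y ≤ x generalizing x y
  · rw [abs_sub_comm, ← neg_sub, neg_sq]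
    exact this y x (le_of_not_ge hxy)
  rw [abs_of_nonneg (sub_nonneg.mpr hxy)]
  have hle := Real.sqrt_le_sqrt hxy
  have hy := Real.sqrt_nonneg y
  rcases le_total 0 y with h0 | h0
  · nlinarith [Real.sq_sqrt h0, Real.sq_sqrt (h0.trans hxy)]
  · rw [Real.sqrt_eq_zero_of_nonpos h0, sub_zero]
    rcases le_total 0 x with h1 | h1
    · linarith [Real.sq_sqrt h1]
    · rw [Real.sqrt_eq_zero_of_nonpos h1]
      linarith

lemma gV_sub_gV (θv σv s u x y : ℝ) :
    gV θv σv s u x - gV θv σv s u y = σv * u * (√x - √y) := by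
  have h (z : ℝ) : √z * indPos z = √z := by
    unfold indPos
    split_ifs with hz
    · rw [mul_one]
    · rw [Real.sqrt_eq_zero_of_nonpos (not_lt.mp hz), zero_mul]
  simp only [gV, mul_assoc, h]
  ring

/-- The square-root Hölder-type estimate used in the Yamada–Watanabe pathwise-uniqueness
argument: there is a constant `C > 0` such that
`∫_{ℝ²} (g_V(s,u,x) − g_V(s,u,y))² dν₁(s,u) ≤ C|x − y|` for all `x, y ∈ ℝ`. -/
theorem gV_sq_difference_integral_holder (α β κv av σv θv : ℝ)
    (hα : 0 < α) (hβ : 0 < β) (hκv : 0 < κv) (hav : 0 < av) (hσv : 0 < σv) (hθv : 0 ≤ θv) :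
    ∃ C > 0, ∀ x y : ℝ,
      (∫⁻ q : ℝ × ℝ,
          ENNReal.ofReal ((gV θv σv q.1 q.2 x - gV θv σv q.1 q.2 y) ^ 2) ∂nu1 α β) ≤
        ENNReal.ofReal (C * |x - y|) := by
  set M := ∫⁻ q : ℝ × ℝ, ENNReal.ofReal (q.2 ^ 2) ∂nu1 α β
  have hM : M < ⊤ := lintegral_snd_sq_nu1_lt_top hα.le hβ
  refine ⟨σv ^ 2 * (M.toReal + 1), by positivity, fun x y => ?_⟩
  calc ∫⁻ q : ℝ × ℝ,
          ENNReal.ofReal ((gV θv σv q.1 q.2 x - gV θv σv q.1 q.2 y) ^ 2) ∂nu1 α β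
      = ∫⁻ q : ℝ × ℝ, ENNReal.ofReal (σv ^ 2 * (√x - √y) ^ 2) * ENNReal.ofReal (q.2 ^ 2)
          ∂nu1 α β := by
        refine lintegral_congr fun q => ?_
        rw [gV_sub_gV, ← ENNReal.ofReal_mul (by positivity)]
        congr 1
        ring
    _ = ENNReal.ofReal (σv ^ 2 * (√x - √y) ^ 2 * M.toReal) := by
        rw [lintegral_const_mul' _ _ ENNReal.ofReal_ne_top,
          ENNReal.ofReal_mul (p := σv ^ 2 * (√x - √y) ^ 2) (by positivity),
          ENNReal.ofReal_toReal hM.ne]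
    _ ≤ ENNReal.ofReal (σv ^ 2 * (M.toReal + 1) * |x - y|) := by
        refine ENNReal.ofReal_le_ofReal ?_
        calc σv ^ 2 * (√x - √y) ^ 2 * M.toReal
            ≤ σv ^ 2 * |x - y| * (M.toReal + 1) := by
              gcongr
              · exact sq_sqrt_sub_sqrt_le x y
              · linarith
          _ = σv ^ 2 * (M.toReal + 1) * |x - y| := by ring
end

section
/- Let κ_v, a_v, σ_v, κ_f, a_f, σ_f > 0, θ_v, θ_f ≥ 0, ρ_{sf}, ρ_{vf} ∈ (−1,1), let n ≥ 1 be an integer and let ψ : ℝ → ℝ be a smooth compactly supported function with 0 ≤ ψ ≤ 1, ψ(x) = 1 for x ∈ [1/n, n], and support of ψ contained in (1/(n+1), n+1). For x = (x₁,x₂) ∈ ℝ² define b_n(x) = ( κ_v(a_v − x₁), κ_f(a_f − x₂) − σ_f·ρ_{sf}·ψ(x₁)·ψ(x₂)·√(max(x₁,0)·max(x₂,0)) ) and, for s ∈ ℝ and u = (u₁,u₂) ∈ ℝ², define g_n(s,u,x) ∈ ℝ² by (g_n)₁(s,u,x) = θ_v·s + σ_v·u₁·ψ(x₁)·√(max(x₁,0))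 and (g_n)₂(s,u,x) = θ_f·s + σ_f·ρ_{vf}·u₁·ψ(x₂)·√(max(x₂,0)) + σ_f·√(1−ρ_{vf}²)·u₂·ψ(x₂)·√(max(x₂,0)). Then there exists a constant C > 0 such that: (a) for every x ∈ ℝ², |b_n(x)|² + ∫_{ℝ³} |g_n(s,u,x)|² dν₂(s,u) ≤ C(1 + |x|²); (b) for all s ∈ ℝ, u ∈ ℝ², x, y ∈ ℝ², |g_n(s,u,x) − g_n(s,u,y)| ≤ C·|u|·|x − y|; and (c) for all x, y ∈ ℝ², |b_n(x) − b_n(y)|² + ∫_{ℝ³} |g_n(s,u,x) − g_n(s,u,y)|² dν₂(s,u) ≤ C|x − y|². (These are the Lipschitz and sublinear-growth conditions for the localized coupled system used when ρ_{sf} < 0.) -/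
open MeasureTheory Real Set

/-- The two-dimensional heat kernel `p₂(s,u) = (2πs)^{−1}·e^{−|u|²/(2s)}` for `s > 0`. -/
noncomputable def p2 (s : ℝ) (u : ℝ × ℝ) : ℝ :=
  if 0 < s then (2 * Real.pi * s)⁻¹ * Real.exp (-(u.1 ^ 2 + u.2 ^ 2) / (2 * s)) else 0

/-- The measure `ν₂` on `ℝ³ = ℝ × ℝ²` with density `(s,u) ↦ g_γ(s)·p₂(s,u)` w.r.t. Lebesgue
measure. -/
noncomputable def nu2 (α β : ℝ) : Measure (ℝ × ℝ × ℝ) :=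
  (volume : Measure (ℝ × ℝ × ℝ)).withDensity fun q =>
    ENNReal.ofReal (gGamma α β q.1 * p2 q.1 q.2)

/-- The localized drift of the coupled variance/foreign-rate system. -/
noncomputable def bLoc (κv av κf af σf ρsf : ℝ) (ψ : ℝ → ℝ) (x : ℝ × ℝ) : ℝ × ℝ :=
  (κv * (av - x.1),
    κf * (af - x.2) - σf * ρsf * ψ x.1 * ψ x.2 * Real.sqrt (max x.1 0 * max x.2 0))

/-- First component of the localized jump coefficient of the coupled system. -/
noncomputable def gLoc1 (θv σv : ℝ) (ψ : ℝ → ℝ) (s : ℝ) (u x : ℝ × ℝ) : ℝ :=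
  θv * s + σv * u.1 * ψ x.1 * Real.sqrt (max x.1 0)

/-- Second component of the localized jump coefficient of the coupled system. -/
noncomputable def gLoc2 (θf σf ρvf : ℝ) (ψ : ℝ → ℝ) (s : ℝ) (u x : ℝ × ℝ) : ℝ :=
  θf * s + σf * ρvf * u.1 * ψ x.2 * Real.sqrt (max x.2 0) +
    σf * Real.sqrt (1 - ρvf ^ 2) * u.2 * ψ x.2 * Real.sqrt (max x.2 0)

/-- A `C¹` cutoff supported away from `0` makes `t ↦ ψ t * √t⁺` bounded and Lipschitz. -/
lemma exists_sq_bound_cutoff_mul_sqrt {ψ : ℝ → ℝ} {a b : ℝ} (ha : 0 < a)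
    (hψ : ContDiff ℝ 1 ψ) (hc : HasCompactSupport ψ) (hs : Function.support ψ ⊆ Set.Ioo a b) :
    ∃ P Q : ℝ, 0 ≤ P ∧ 0 ≤ Q ∧
      (∀ x, (ψ x * Real.sqrt (max x 0)) ^ 2 ≤ P) ∧
      ∀ x y, (ψ x * Real.sqrt (max x 0) - ψ y * Real.sqrt (max y 0)) ^ 2 ≤ Q * (x - y) ^ 2 := by
  have hcd : ContDiff ℝ 1 fun x => ψ x * Real.sqrt (max x 0) := by
    rw [contDiff_iff_contDiffAt]
    intro x
    rcases lt_or_ge x a with hx | hx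
    · refine (contDiffAt_const (c := (0 : ℝ))).congr_of_eventuallyEq ?_
      filter_upwards [Iio_mem_nhds hx] with y hy
      have h0 : ψ y = 0 := by
        by_contra h
        exact absurd (hs h).1 (not_lt.mpr (le_of_lt hy))
      simp [h0]
    · have hx0 : 0 < x := ha.trans_le hx
      refine hψ.contDiffAt.mul
        (((Real.contDiffAt_sqrt hx0.ne').congr_of_eventuallyEq ?_))
      filter_upwards [Ioi_mem_nhds hx0] with y hy
      rw [max_eq_left (le_of_lt hy)]
  have hcs : HasCompactSupport fun x => ψ x * Real.sqrt (max x 0) := hc.mul_right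
  obtain ⟨L, hL⟩ := hcd.lipschitzWith_of_hasCompactSupport hcs one_ne_zero
  obtain ⟨B, hB⟩ := hcs.exists_bound_of_continuous hcd.continuous
  refine ⟨B ^ 2, (L : ℝ) ^ 2, sq_nonneg _, sq_nonneg _, fun x => ?_, fun x y => ?_⟩
  · exact sq_le_sq' (abs_le.mp (hB x)).1 (abs_le.mp (hB x)).2
  · have h := hL.dist_le_mul x y
    rw [Real.dist_eq, Real.dist_eq] at h
    rw [← sq_abs (_ - _), ← sq_abs (x - y), ← mul_pow]
    exact pow_le_pow_left₀ (abs_nonneg _) h 2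

lemma measurable_gGamma_mul_p2 (α β : ℝ) :
    Measurable fun q : ℝ × ℝ × ℝ => ENNReal.ofReal (gGamma α β q.1 * p2 q.1 q.2) := by
  have hm : MeasurableSet {q : ℝ × ℝ × ℝ | 0 < q.1} :=
    measurableSet_lt measurable_const measurable_fst
  unfold gGamma p2
  exact ((Measurable.ite hm (by fun_prop) measurable_const).mul
    (Measurable.ite hm (by fun_prop) measurable_const)).ennreal_ofReal

lemma lintegral_exp_neg_mul_sq_add_sq {b : ℝ} (hb : 0 < b) :
    ∫⁻ u : ℝ × ℝ, ENNReal.ofReal (Real.exp (-b * (u.1 ^ 2 + u.2 ^ 2))) =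
      ENNReal.ofReal (π / b) := by
  have hi : Integrable (fun u : ℝ × ℝ => Real.exp (-b * u.1 ^ 2) * Real.exp (-b * u.2 ^ 2)) :=
    (integrable_exp_neg_mul_sq hb).mul_prod (integrable_exp_neg_mul_sq hb)
  simp_rw [mul_add, Real.exp_add]
  rw [← ofReal_integral_eq_lintegral_ofReal hi (ae_of_all _ fun _ => by positivity)]
  congr 1
  rw [Measure.volume_eq_prod,
    integral_prod_mul (fun x : ℝ => Real.exp (-b * x ^ 2)) (fun x : ℝ => Real.exp (-b * x ^ 2)),
    integral_gaussian, Real.mul_self_sqrt (by positivity)]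

lemma gGamma_mul_p2_mul_le {α β s : ℝ} (hα : 0 < α) (hs : 0 < s) (u : ℝ × ℝ) :
    gGamma α β s * p2 s u * (s ^ 2 + (u.1 ^ 2 + u.2 ^ 2)) ≤
      (α * Real.exp (-β * s) * (2 * π * s)⁻¹ * (s + 4)) *
        Real.exp (-(1 / (4 * s)) * (u.1 ^ 2 + u.2 ^ 2)) := by
  simp only [gGamma, p2, if_pos hs]
  set r := u.1 ^ 2 + u.2 ^ 2 with hr
  have hr0 : 0 ≤ r := by positivity
  set t := 1 / (4 * s) * r with ht
  have ht0 : 0 ≤ t := by positivity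
  have hr' : r = 4 * s * t := by rw [ht]; field_simp
  have e1 : -r / (2 * s) = -t + -t := by rw [hr']; field_simp; ring
  have e2 : -(1 / (4 * s)) * r = -t := by rw [ht]; ring
  rw [e1, e2, Real.exp_add]
  have h1 : t * Real.exp (-t) ≤ 1 := by
    rw [Real.exp_neg, mul_inv_le_iff₀ (Real.exp_pos t)]
    linarith [Real.add_one_le_exp t]
  have h2 : Real.exp (-t) ≤ 1 := Real.exp_le_one_iff.mpr (by linarith)
  have h3 : Real.exp (-t) * (s ^ 2 + r) ≤ s * (s + 4) := by
    rw [hr']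
    nlinarith [mul_le_mul_of_nonneg_left h1 hs.le, mul_le_mul_of_nonneg_left h2 (sq_nonneg s)]
  calc α / s * Real.exp (-β * s) * ((2 * π * s)⁻¹ * (Real.exp (-t) * Real.exp (-t))) * (s ^ 2 + r)
      = (α / s * Real.exp (-β * s) * (2 * π * s)⁻¹ * Real.exp (-t)) *
          (Real.exp (-t) * (s ^ 2 + r)) := by ring
    _ ≤ (α / s * Real.exp (-β * s) * (2 * π * s)⁻¹ * Real.exp (-t)) * (s * (s + 4)) := by
        gcongr
    _ = _ := by field_simp

/-- The measure `ν₂` has finite second moments. -/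
lemma lintegral_sq_nu2_lt_top {α β : ℝ} (hα : 0 < α) (hβ : 0 < β) :
    ∫⁻ q : ℝ × ℝ × ℝ, ENNReal.ofReal (q.1 ^ 2 + (q.2.1 ^ 2 + q.2.2 ^ 2)) ∂nu2 α β < ⊤ := by
  have hint : Integrable (fun s : ℝ => α * 2 * (s * Real.exp (-β * s) + 4 * Real.exp (-β * s)))
      (volume.restrict (Set.Ioi 0)) := by
    refine Integrable.const_mul (Integrable.add ?_ ?_) _
    · have := integrableOn_rpow_mul_exp_neg_mul_rpow (s := 1) (p := 1) (by norm_num)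
        (by norm_num) hβ
      simpa [IntegrableOn] using this
    · exact (exp_neg_integrableOn_Ioi 0 hβ).const_mul 4
  refine lt_of_le_of_lt ?_ hint.lintegral_lt_top
  refine (lintegral_withDensity_le_lintegral_mul _ (measurable_gGamma_mul_p2 α β) _).trans ?_
  rw [Measure.volume_eq_prod]
  refine (lintegral_prod_le _).trans ?_
  rw [← lintegral_indicator measurableSet_Ioi]
  refine lintegral_mono fun s => ?_
  by_cases hs : 0 < s
  · rw [Set.indicator_of_mem (Set.mem_Ioi.mpr hs)]
    have hpt : ∀ u : ℝ × ℝ,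
        ENNReal.ofReal (gGamma α β s * p2 s u) * ENNReal.ofReal (s ^ 2 + (u.1 ^ 2 + u.2 ^ 2)) ≤
        ENNReal.ofReal (α * Real.exp (-β * s) * (2 * π * s)⁻¹ * (s + 4)) *
          ENNReal.ofReal (Real.exp (-(1 / (4 * s)) * (u.1 ^ 2 + u.2 ^ 2))) := fun u => by
      rw [← ENNReal.ofReal_mul' (by positivity), ← ENNReal.ofReal_mul (by positivity)]
      exact ENNReal.ofReal_le_ofReal (gGamma_mul_p2_mul_le hα hs u)
    refine (lintegral_mono hpt).trans ?_
    rw [lintegral_const_mul' _ _ ENNReal.ofReal_ne_top,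
      lintegral_exp_neg_mul_sq_add_sq (by positivity), ← ENNReal.ofReal_mul (by positivity)]
    refine ENNReal.ofReal_le_ofReal (le_of_eq ?_)
    field_simp
    ring
  · rw [Set.indicator_of_notMem (by simpa using hs)]
    simp [gGamma, hs]

lemma lintegral_ofReal_le_of_le_mul {Ω : Type*} [MeasurableSpace Ω] {μ : Measure Ω}
    {f g : Ω → ℝ} {K : ℝ} (hK : 0 ≤ K) (hg : ∫⁻ q, ENNReal.ofReal (g q) ∂μ < ⊤)
    (hfg : ∀ q, f q ≤ K * g q) :
    ∫⁻ q, ENNReal.ofReal (f q) ∂μ < ⊤ ∧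
      (∫⁻ q, ENNReal.ofReal (f q) ∂μ).toReal ≤ K * (∫⁻ q, ENNReal.ofReal (g q) ∂μ).toReal := by
  have h : ∫⁻ q, ENNReal.ofReal (f q) ∂μ ≤
      ENNReal.ofReal K * ∫⁻ q, ENNReal.ofReal (g q) ∂μ := by
    rw [← lintegral_const_mul' _ _ ENNReal.ofReal_ne_top]
    refine lintegral_mono fun q => ?_
    rw [← ENNReal.ofReal_mul hK]
    exact ENNReal.ofReal_le_ofReal (hfg q)
  have ht : ENNReal.ofReal K * ∫⁻ q, ENNReal.ofReal (g q) ∂μ < ⊤ :=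
    ENNReal.mul_lt_top ENNReal.ofReal_lt_top hg
  refine ⟨h.trans_lt ht, (ENNReal.toReal_mono ht.ne h).trans_eq ?_⟩
  rw [ENNReal.toReal_mul, ENNReal.toReal_ofReal hK]

lemma sq_mul_add_mul_le (a b x y : ℝ) :
    (a * x + b * y) ^ 2 ≤ (a ^ 2 + b ^ 2) * (x ^ 2 + y ^ 2) := by
  nlinarith [sq_nonneg (a * y - b * x)]

section Coefficients

variable {ψ : ℝ → ℝ} {P Q : ℝ}

lemma gLoc_sq_le (θv σv θf σf ρvf : ℝ) (hP0 : 0 ≤ P)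
    (hP : ∀ x, (ψ x * Real.sqrt (max x 0)) ^ 2 ≤ P) (s : ℝ) (u x : ℝ × ℝ) :
    gLoc1 θv σv ψ s u x ^ 2 + gLoc2 θf σf ρvf ψ s u x ^ 2 ≤
      (2 * (θv ^ 2 + θf ^ 2) +
        2 * P * (σv ^ 2 + ((σf * ρvf) ^ 2 + (σf * Real.sqrt (1 - ρvf ^ 2)) ^ 2))) *
      (s ^ 2 + (u.1 ^ 2 + u.2 ^ 2)) := by
  have h1 := add_sq_le (a := θv * s) (b := σv * u.1 * (ψ x.1 * Real.sqrt (max x.1 0)))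
  have h2 := add_sq_le (a := θf * s)
    (b := (σf * ρvf * u.1 + σf * Real.sqrt (1 - ρvf ^ 2) * u.2) *
      (ψ x.2 * Real.sqrt (max x.2 0)))
  have e1 : gLoc1 θv σv ψ s u x =
      θv * s + σv * u.1 * (ψ x.1 * Real.sqrt (max x.1 0)) := by
    unfold gLoc1; ring
  have e2 : gLoc2 θf σf ρvf ψ s u x =
      θf * s + (σf * ρvf * u.1 + σf * Real.sqrt (1 - ρvf ^ 2) * u.2) *
        (ψ x.2 * Real.sqrt (max x.2 0)) := by
    unfold gLoc2; ring
  rw [e1, e2]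
  have p1 := hP x.1
  have p2 := hP x.2
  have h3 := sq_mul_add_mul_le (σf * ρvf) (σf * Real.sqrt (1 - ρvf ^ 2)) u.1 u.2
  set a := σf * ρvf
  set b := σf * Real.sqrt (1 - ρvf ^ 2)
  set v := ψ x.1 * Real.sqrt (max x.1 0)
  set w := ψ x.2 * Real.sqrt (max x.2 0)
  have h4 : (σv * u.1 * v) ^ 2 ≤ σv ^ 2 * (u.1 ^ 2 + u.2 ^ 2) * P := by
    rw [mul_pow, mul_pow]
    gcongr
    linarith [sq_nonneg u.2]
  have h5 : ((a * u.1 + b * u.2) * w) ^ 2 ≤ (a ^ 2 + b ^ 2) * (u.1 ^ 2 + u.2 ^ 2) * P := by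
    rw [mul_pow]
    gcongr
  have h6 : 0 ≤ 2 * P * (σv ^ 2 + (a ^ 2 + b ^ 2)) * s ^ 2 := by positivity
  have h7 : 0 ≤ 2 * (θv ^ 2 + θf ^ 2) * (u.1 ^ 2 + u.2 ^ 2) := by positivity
  linarith

lemma gLoc_sub_sq_le (θv σv θf σf ρvf : ℝ) (hQ0 : 0 ≤ Q)
    (hQ : ∀ x y, (ψ x * Real.sqrt (max x 0) - ψ y * Real.sqrt (max y 0)) ^ 2 ≤ Q * (x - y) ^ 2)
    (s : ℝ) (u x y : ℝ × ℝ) :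
    (gLoc1 θv σv ψ s u x - gLoc1 θv σv ψ s u y) ^ 2 +
        (gLoc2 θf σf ρvf ψ s u x - gLoc2 θf σf ρvf ψ s u y) ^ 2 ≤
      (Q * (σv ^ 2 + ((σf * ρvf) ^ 2 + (σf * Real.sqrt (1 - ρvf ^ 2)) ^ 2))) *
      (u.1 ^ 2 + u.2 ^ 2) * ((x.1 - y.1) ^ 2 + (x.2 - y.2) ^ 2) := by
  have e1 : gLoc1 θv σv ψ s u x - gLoc1 θv σv ψ s u y =
      σv * u.1 * (ψ x.1 * Real.sqrt (max x.1 0) - ψ y.1 * Real.sqrt (max y.1 0)) := by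
    unfold gLoc1; ring
  have e2 : gLoc2 θf σf ρvf ψ s u x - gLoc2 θf σf ρvf ψ s u y =
      (σf * ρvf * u.1 + σf * Real.sqrt (1 - ρvf ^ 2) * u.2) *
        (ψ x.2 * Real.sqrt (max x.2 0) - ψ y.2 * Real.sqrt (max y.2 0)) := by
    unfold gLoc2; ring
  rw [e1, e2]
  have q1 := hQ x.1 y.1
  have q2 := hQ x.2 y.2
  have h3 := sq_mul_add_mul_le (σf * ρvf) (σf * Real.sqrt (1 - ρvf ^ 2)) u.1 u.2
  set a := σf * ρvf
  set b := σf * Real.sqrt (1 - ρvf ^ 2)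
  set v := ψ x.1 * Real.sqrt (max x.1 0) - ψ y.1 * Real.sqrt (max y.1 0)
  set w := ψ x.2 * Real.sqrt (max x.2 0) - ψ y.2 * Real.sqrt (max y.2 0)
  have h4 : (σv * u.1 * v) ^ 2 ≤ σv ^ 2 * (u.1 ^ 2 + u.2 ^ 2) * (Q * (x.1 - y.1) ^ 2) := by
    rw [mul_pow, mul_pow]
    gcongr
    linarith [sq_nonneg u.2]
  have h5 : ((a * u.1 + b * u.2) * w) ^ 2 ≤
      (a ^ 2 + b ^ 2) * (u.1 ^ 2 + u.2 ^ 2) * (Q * (x.2 - y.2) ^ 2) := by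
    rw [mul_pow]
    gcongr
  have h6 : 0 ≤ Q * σv ^ 2 * (u.1 ^ 2 + u.2 ^ 2) * (x.2 - y.2) ^ 2 := by positivity
  have h7 : 0 ≤ Q * (a ^ 2 + b ^ 2) * (u.1 ^ 2 + u.2 ^ 2) * (x.1 - y.1) ^ 2 := by positivity
  linarith

lemma bLoc_snd_eq (κv av κf af σf ρsf : ℝ) (ψ : ℝ → ℝ) (x : ℝ × ℝ) :
    (bLoc κv av κf af σf ρsf ψ x).2 = κf * (af - x.2) -
      σf * ρsf * ((ψ x.1 * Real.sqrt (max x.1 0)) * (ψ x.2 * Real.sqrt (max x.2 0))) := by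
  simp only [bLoc, Real.sqrt_mul (le_max_right x.1 0)]
  ring

lemma bLoc_sq_le (κv av κf af σf ρsf : ℝ) (hP0 : 0 ≤ P)
    (hP : ∀ x, (ψ x * Real.sqrt (max x 0)) ^ 2 ≤ P) (x : ℝ × ℝ) :
    (bLoc κv av κf af σf ρsf ψ x).1 ^ 2 + (bLoc κv av κf af σf ρsf ψ x).2 ^ 2 ≤
      (2 * κv ^ 2 * (av ^ 2 + 1) + 4 * κf ^ 2 * (af ^ 2 + 1) + 2 * (σf * ρsf) ^ 2 * P ^ 2) *
        (1 + (x.1 ^ 2 + x.2 ^ 2)) := by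
  have e1 : (bLoc κv av κf af σf ρsf ψ x).1 = κv * (av - x.1) := rfl
  rw [e1, bLoc_snd_eq]
  have p1 := hP x.1
  have p2 := hP x.2
  set c := σf * ρsf
  set v := ψ x.1 * Real.sqrt (max x.1 0)
  set w := ψ x.2 * Real.sqrt (max x.2 0)
  have hr1 : 0 ≤ x.1 ^ 2 := sq_nonneg _
  have hr2 : 0 ≤ x.2 ^ 2 := sq_nonneg _
  have aux : ∀ d z : ℝ, (d - z) ^ 2 ≤ 2 * (d ^ 2 + z ^ 2) := fun d z => by
    nlinarith [sq_nonneg (d + z)]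
  have aux' : ∀ d z : ℝ, z ^ 2 ≤ x.1 ^ 2 + x.2 ^ 2 →
      (d - z) ^ 2 ≤ 2 * ((d ^ 2 + 1) * (1 + (x.1 ^ 2 + x.2 ^ 2))) := fun d z hz => by
    nlinarith [aux d z, mul_nonneg (sq_nonneg d) (add_nonneg hr1 hr2)]
  have h1 : (κv * (av - x.1)) ^ 2 ≤
      κv ^ 2 * (2 * ((av ^ 2 + 1) * (1 + (x.1 ^ 2 + x.2 ^ 2)))) := by
    rw [mul_pow]
    gcongr
    exact aux' av x.1 (by linarith)
  have h2 : (κf * (af - x.2)) ^ 2 ≤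
      κf ^ 2 * (2 * ((af ^ 2 + 1) * (1 + (x.1 ^ 2 + x.2 ^ 2)))) := by
    rw [mul_pow]
    gcongr
    exact aux' af x.2 (by linarith)
  have h3 : (c * (v * w)) ^ 2 ≤ c ^ 2 * P ^ 2 := by
    rw [mul_pow, mul_pow v, sq P]
    gcongr
  have h4 := aux (κf * (af - x.2)) (c * (v * w))
  have h5 : 0 ≤ c ^ 2 * P ^ 2 * (x.1 ^ 2 + x.2 ^ 2) := by positivity
  linarith

lemma bLoc_sub_sq_le (κv av κf af σf ρsf : ℝ) (hP0 : 0 ≤ P) (hQ0 : 0 ≤ Q)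
    (hP : ∀ x, (ψ x * Real.sqrt (max x 0)) ^ 2 ≤ P)
    (hQ : ∀ x y, (ψ x * Real.sqrt (max x 0) - ψ y * Real.sqrt (max y 0)) ^ 2 ≤ Q * (x - y) ^ 2)
    (x y : ℝ × ℝ) :
    ((bLoc κv av κf af σf ρsf ψ x).1 - (bLoc κv av κf af σf ρsf ψ y).1) ^ 2 +
        ((bLoc κv av κf af σf ρsf ψ x).2 - (bLoc κv av κf af σf ρsf ψ y).2) ^ 2 ≤
      (κv ^ 2 + 2 * κf ^ 2 + 4 * (σf * ρsf) ^ 2 * P * Q) *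
        ((x.1 - y.1) ^ 2 + (x.2 - y.2) ^ 2) := by
  have e1 : (bLoc κv av κf af σf ρsf ψ x).1 - (bLoc κv av κf af σf ρsf ψ y).1 =
      -(κv * (x.1 - y.1)) := by
    simp only [bLoc]; ring
  rw [e1, bLoc_snd_eq, bLoc_snd_eq]
  have p1 := hP x.2
  have p2 := hP y.1
  have q1 := hQ x.1 y.1
  have q2 := hQ x.2 y.2
  set c := σf * ρsf
  set v := ψ x.1 * Real.sqrt (max x.1 0)
  set w := ψ x.2 * Real.sqrt (max x.2 0)
  set v' := ψ y.1 * Real.sqrt (max y.1 0)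
  set w' := ψ y.2 * Real.sqrt (max y.2 0)
  have h1 : ((v - v') * w) ^ 2 ≤ Q * (x.1 - y.1) ^ 2 * P := by
    rw [mul_pow]
    gcongr
  have h2 : (v' * (w - w')) ^ 2 ≤ P * (Q * (x.2 - y.2) ^ 2) := by
    rw [mul_pow]
    gcongr
  have h3 : (v * w - v' * w') ^ 2 ≤ 2 * P * Q * ((x.1 - y.1) ^ 2 + (x.2 - y.2) ^ 2) := by
    have h := add_sq_le (a := (v - v') * w) (b := v' * (w - w'))
    have e : v * w - v' * w' = (v - v') * w + v' * (w - w') := by ring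
    rw [e]
    linarith
  have h4 := add_sq_le (a := -(κf * (x.2 - y.2))) (b := -(c * (v * w - v' * w')))
  have e2 : κf * (af - x.2) - c * (v * w) - (κf * (af - y.2) - c * (v' * w')) =
      -(κf * (x.2 - y.2)) + -(c * (v * w - v' * w')) := by ring
  rw [e2]
  have h5 := mul_le_mul_of_nonneg_left h3 (sq_nonneg c)
  have h6 : 0 ≤ κv ^ 2 * (x.2 - y.2) ^ 2 := by positivity
  have h7 : 0 ≤ κf ^ 2 * (x.1 - y.1) ^ 2 := by positivity
  simp only [neg_sq, mul_pow] at h4 ⊢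
  linarith

end Coefficients

/-- Lipschitz and sublinear-growth conditions for the localized coupled variance/foreign-rate
system (used when `ρ_{sf} < 0`): with `ψ` a smooth cutoff that is `1` on `[1/n, n]` and is
supported in `(1/(n+1), n+1)`, there is `C > 0` such that
(a) `|b_n(x)|² + ∫_{ℝ³} |g_n(s,u,x)|² dν₂(s,u) ≤ C(1 + |x|²)`,
(b) `|g_n(s,u,x) − g_n(s,u,y)| ≤ C·|u|·|x − y|`, and
(c) `|b_n(x) − b_n(y)|² + ∫_{ℝ³} |g_n(s,u,x) − g_n(s,u,y)|² dν₂(s,u) ≤ C|x − y|²`. -/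
theorem localized_coupled_system_lipschitz_growth
    (α β κv av σv θv κf af σf θf ρsf ρvf : ℝ)
    (hα : 0 < α) (hβ : 0 < β) (hκv : 0 < κv) (hav : 0 < av) (hσv : 0 < σv)
    (hκf : 0 < κf) (haf : 0 < af) (hσf : 0 < σf) (hθv : 0 ≤ θv) (hθf : 0 ≤ θf)
    (hρsf : ρsf ∈ Set.Ioo (-1 : ℝ) 1) (hρvf : ρvf ∈ Set.Ioo (-1 : ℝ) 1)
    (n : ℕ) (hn : 1 ≤ n) (ψ : ℝ → ℝ)
    (hψ_smooth : ContDiff ℝ (⊤ : ℕ∞) ψ) (hψ_cpt : HasCompactSupport ψ)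
    (hψ_mem : ∀ x, ψ x ∈ Set.Icc (0 : ℝ) 1)
    (hψ_one : ∀ x ∈ Set.Icc (1 / (n : ℝ)) (n : ℝ), ψ x = 1)
    (hψ_supp : Function.support ψ ⊆ Set.Ioo (1 / ((n : ℝ) + 1)) ((n : ℝ) + 1)) :
    ∃ C > 0,
      (∀ x : ℝ × ℝ,
        (∫⁻ q : ℝ × ℝ × ℝ,
            ENNReal.ofReal ((gLoc1 θv σv ψ q.1 q.2 x) ^ 2 + (gLoc2 θf σf ρvf ψ q.1 q.2 x) ^ 2)
              ∂nu2 α β) < ⊤ ∧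
        (bLoc κv av κf af σf ρsf ψ x).1 ^ 2 + (bLoc κv av κf af σf ρsf ψ x).2 ^ 2 +
            (∫⁻ q : ℝ × ℝ × ℝ,
              ENNReal.ofReal
                ((gLoc1 θv σv ψ q.1 q.2 x) ^ 2 + (gLoc2 θf σf ρvf ψ q.1 q.2 x) ^ 2)
                ∂nu2 α β).toReal ≤
          C * (1 + (x.1 ^ 2 + x.2 ^ 2))) ∧
      (∀ (s : ℝ) (u x y : ℝ × ℝ),
        Real.sqrt ((gLoc1 θv σv ψ s u x - gLoc1 θv σv ψ s u y) ^ 2 +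
            (gLoc2 θf σf ρvf ψ s u x - gLoc2 θf σf ρvf ψ s u y) ^ 2) ≤
          C * Real.sqrt (u.1 ^ 2 + u.2 ^ 2) *
            Real.sqrt ((x.1 - y.1) ^ 2 + (x.2 - y.2) ^ 2)) ∧
      (∀ x y : ℝ × ℝ,
        ((bLoc κv av κf af σf ρsf ψ x).1 - (bLoc κv av κf af σf ρsf ψ y).1) ^ 2 +
            ((bLoc κv av κf af σf ρsf ψ x).2 - (bLoc κv av κf af σf ρsf ψ y).2) ^ 2 +
            (∫⁻ q : ℝ × ℝ × ℝ,
              ENNReal.ofReal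
                ((gLoc1 θv σv ψ q.1 q.2 x - gLoc1 θv σv ψ q.1 q.2 y) ^ 2 +
                  (gLoc2 θf σf ρvf ψ q.1 q.2 x - gLoc2 θf σf ρvf ψ q.1 q.2 y) ^ 2)
                ∂nu2 α β).toReal ≤
          C * ((x.1 - y.1) ^ 2 + (x.2 - y.2) ^ 2)) := by
  obtain ⟨P, Q, hP0, hQ0, hP, hQ⟩ := exists_sq_bound_cutoff_mul_sqrt (by positivity)
    (hψ_smooth.of_le (by exact_mod_cast le_top)) hψ_cpt hψ_supp
  have hM := lintegral_sq_nu2_lt_top hα hβ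
  set M := (∫⁻ q : ℝ × ℝ × ℝ,
    ENNReal.ofReal (q.1 ^ 2 + (q.2.1 ^ 2 + q.2.2 ^ 2)) ∂nu2 α β).toReal with hMdef
  have hM0 : 0 ≤ M := ENNReal.toReal_nonneg
  set R := σv ^ 2 + ((σf * ρvf) ^ 2 + (σf * Real.sqrt (1 - ρvf ^ 2)) ^ 2) with hR
  have hR0 : 0 ≤ R := by positivity
  set K := 2 * (θv ^ 2 + θf ^ 2) + 2 * P * R with hK
  have hK0 : 0 ≤ K := by positivity
  set A := 2 * κv ^ 2 * (av ^ 2 + 1) + 4 * κf ^ 2 * (af ^ 2 + 1) +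
    2 * (σf * ρsf) ^ 2 * P ^ 2 with hA
  have hA0 : 0 ≤ A := by positivity
  set D := κv ^ 2 + 2 * κf ^ 2 + 4 * (σf * ρsf) ^ 2 * P * Q with hD
  have hD0 : 0 ≤ D := by positivity
  have hKM : 0 ≤ K * M := by positivity
  have hQRM : 0 ≤ Q * R * M := by positivity
  have hS : 0 ≤ Real.sqrt (Q * R) := Real.sqrt_nonneg _
  refine ⟨1 + (A + K * M) + Real.sqrt (Q * R) + (D + Q * R * M), by positivity,
    fun x => ?_, fun s u x y => ?_, fun x y => ?_⟩
  · obtain ⟨h1, h2⟩ := lintegral_ofReal_le_of_le_mul hK0 hM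
      fun q => gLoc_sq_le θv σv θf σf ρvf hP0 hP q.1 q.2 x
    refine ⟨h1, ?_⟩
    have h3 := bLoc_sq_le κv av κf af σf ρsf hP0 hP x
    have hx : 0 ≤ x.1 ^ 2 + x.2 ^ 2 := by positivity
    calc _ ≤ A * (1 + (x.1 ^ 2 + x.2 ^ 2)) + K * M := add_le_add h3 h2
      _ ≤ (A + K * M) * (1 + (x.1 ^ 2 + x.2 ^ 2)) := by
        linarith [mul_nonneg hKM hx]
      _ ≤ _ := mul_le_mul_of_nonneg_right (by linarith) (by positivity)
  · have h := Real.sqrt_le_sqrt (gLoc_sub_sq_le θv σv θf σf ρvf hQ0 hQ s u x y)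
    rw [Real.sqrt_mul (by positivity), Real.sqrt_mul (by positivity)] at h
    refine h.trans ?_
    gcongr
    linarith
  · have hxy : 0 ≤ (x.1 - y.1) ^ 2 + (x.2 - y.2) ^ 2 := by positivity
    obtain ⟨-, h2⟩ := lintegral_ofReal_le_of_le_mul
      (K := Q * R * ((x.1 - y.1) ^ 2 + (x.2 - y.2) ^ 2)) (by positivity) hM
      fun q => (gLoc_sub_sq_le θv σv θf σf ρvf hQ0 hQ q.1 q.2 x y).trans (by
        rw [mul_right_comm]
        exact mul_le_mul_of_nonneg_left (by linarith [sq_nonneg q.1]) (by positivity))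
    have h3 := bLoc_sub_sq_le κv av κf af σf ρsf hP0 hQ0 hP hQ x y
    calc _ ≤ D * ((x.1 - y.1) ^ 2 + (x.2 - y.2) ^ 2) +
          Q * R * ((x.1 - y.1) ^ 2 + (x.2 - y.2) ^ 2) * M := add_le_add h3 h2
      _ = (D + Q * R * M) * ((x.1 - y.1) ^ 2 + (x.2 - y.2) ^ 2) := by ring
      _ ≤ _ := mul_le_mul_of_nonneg_right (by linarith) hxy
end

section
/- Let θ_s, θ_v, θ_d, θ_f ≥ 0, σ_v, σ_d, σ_f > 0, let H = (H_{i,j}) be a real 4×4 matrix, let n ≥ 1 be an integer and let ψ : ℝ → ℝ be a smooth compactly supported function with 0 ≤ ψ ≤ 1, ψ(x) = 1 for x ∈ [1/n, n], and support of ψ contained in (1/(n+1), n+1); set ψ^{(5)}(x) = ∏_{j=1}^{4} ψ(x_j) for x ∈ ℝ⁴. For s ∈ ℝ, u ∈ ℝ⁴, x ∈ ℝ⁴, define g(s,u,x) ∈ ℝ⁴ by g₁ = x₁(θ_s·s + H_{1,1}u₁·√(max(x₂,0))), g₂ = θ_v·s + (H_{2,1}u₁ + H_{2,2}u₂)·σ_v·√(max(x₂,0)),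 g₃ = θ_d·s + (H_{3,1}u₁ + H_{3,2}u₂ + H_{3,3}u₃)·σ_d·√(max(x₃,0)), g₄ = θ_f·s + (H_{4,1}u₁ + H_{4,2}u₂ + H_{4,3}u₃ + H_{4,4}u₄)·σ_f·√(max(x₄,0)), and set g_n(s,u,x) = ψ^{(5)}(x)·g(s,u,x). Then there exist functions M_n, L_n : ℝ × ℝ⁴ → ℝ such that: (i) |g_n(s,u,x)| ≤ M_n(s,u) for all s ∈ ℝ and x, u ∈ ℝ⁴; (ii) |g_n(s,u,x) − g_n(s,u,y)| ≤ L_n(s,u)·|x − y| for all s ∈ ℝ and x, y, u ∈ ℝ⁴; and (iii) for every real p ≥ 1, ∫_{ℝ⁵} |M_n(s,u)|^p dν₄(s,u) < +∞ and ∫_{ℝ⁵} |L_n(s,u)|^p dν₄(s,u) < +∞. -/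
open MeasureTheory Real Set

/-- The four-dimensional heat kernel `p₄(s,u) = (2πs)^{−2}·e^{−|u|²/(2s)}` for `s > 0`. -/
noncomputable def p4 (s : ℝ) (u : Fin 4 → ℝ) : ℝ :=
  if 0 < s then ((2 * Real.pi * s) ^ 2)⁻¹ * Real.exp (-(∑ j, u j ^ 2) / (2 * s)) else 0

/-- The measure `ν₄` on `ℝ⁵ = ℝ × ℝ⁴` with density `(s,u) ↦ g_γ(s)·p₄(s,u)` w.r.t. Lebesgue
measure. -/
noncomputable def nu4 (α β : ℝ) : Measure (ℝ × (Fin 4 → ℝ)) :=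
  (volume : Measure (ℝ × (Fin 4 → ℝ))).withDensity fun q =>
    ENNReal.ofReal (gGamma α β q.1 * p4 q.1 q.2)

/-- The product cutoff `ψ^{(5)}(x) = ∏_{j=1}^4 ψ(x_j)`. -/
noncomputable def psi5 (ψ : ℝ → ℝ) (x : Fin 4 → ℝ) : ℝ := ∏ j, ψ (x j)

/-- The jump coefficient `g(s,u,x)` of the full four-factor Heston-CIR system. -/
noncomputable def gFull (θs θv θd θf σv σd σf : ℝ) (H : Matrix (Fin 4) (Fin 4) ℝ)
    (s : ℝ) (u x : Fin 4 → ℝ) : Fin 4 → ℝ :=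
  ![x 0 * (θs * s + H 0 0 * u 0 * Real.sqrt (max (x 1) 0)),
    θv * s + (H 1 0 * u 0 + H 1 1 * u 1) * σv * Real.sqrt (max (x 1) 0),
    θd * s + (H 2 0 * u 0 + H 2 1 * u 1 + H 2 2 * u 2) * σd * Real.sqrt (max (x 2) 0),
    θf * s + (H 3 0 * u 0 + H 3 1 * u 1 + H 3 2 * u 2 + H 3 3 * u 3) * σf *
      Real.sqrt (max (x 3) 0)]

/-- The localized jump coefficient `g_n(s,u,x) = ψ^{(5)}(x)·g(s,u,x)`. -/
noncomputable def gFullLoc (θs θv θd θf σv σd σf : ℝ) (H : Matrix (Fin 4) (Fin 4) ℝ)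
    (ψ : ℝ → ℝ) (s : ℝ) (u x : Fin 4 → ℝ) : Fin 4 → ℝ :=
  fun i => psi5 ψ x * gFull θs θv θd θf σv σd σf H s u x i

/-- The Euclidean norm on `ℝ⁴ = Fin 4 → ℝ`. -/
noncomputable def enorm4 (v : Fin 4 → ℝ) : ℝ := Real.sqrt (∑ j, v j ^ 2)

/-- A bounded function on `ℝ⁴` that is Lipschitz for the Euclidean norm. -/
def IsBddLip (f : (Fin 4 → ℝ) → ℝ) : Prop :=
  ∃ C : ℝ, 0 ≤ C ∧ (∀ x, |f x| ≤ C) ∧ ∀ x y, |f x - f y| ≤ C * enorm4 (x - y)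

lemma enorm4_nonneg (v : Fin 4 → ℝ) : 0 ≤ enorm4 v := Real.sqrt_nonneg _

lemma abs_apply_le_enorm4 (v : Fin 4 → ℝ) (i : Fin 4) : |v i| ≤ enorm4 v :=
  Real.abs_le_sqrt
    (Finset.single_le_sum (f := fun j => v j ^ 2) (fun j _ => sq_nonneg _) (Finset.mem_univ i))

lemma enorm4_le_sum_abs (v : Fin 4 → ℝ) : enorm4 v ≤ ∑ j, |v j| := by
  refine Real.sqrt_le_iff.2 ⟨Finset.sum_nonneg fun j _ => abs_nonneg _, ?_⟩
  simpa only [sq_abs] using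
    Finset.sum_sq_le_sq_sum_of_nonneg (s := Finset.univ) (f := fun j => |v j|)
      fun _ _ => abs_nonneg _

lemma IsBddLip.mul {f g : (Fin 4 → ℝ) → ℝ} (hf : IsBddLip f) (hg : IsBddLip g) :
    IsBddLip fun x => f x * g x := by
  obtain ⟨A, hA, hfb, hfl⟩ := hf
  obtain ⟨B, hB, hgb, hgl⟩ := hg
  have hAB : 0 ≤ A * B := mul_nonneg hA hB
  refine ⟨2 * (A * B), by positivity, fun x => ?_, fun x y => ?_⟩
  · rw [abs_mul]
    have := mul_le_mul (hfb x) (hgb x) (abs_nonneg _) hA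
    linarith
  · have h1 := mul_le_mul (hfb x) (hgl x y) (abs_nonneg _) hA
    have h2 := mul_le_mul (hfl x y) (hgb y) (abs_nonneg _) (mul_nonneg hA (enorm4_nonneg _))
    calc |f x * g x - f y * g y| = |f x * (g x - g y) + (f x - f y) * g y| := by congr 1; ring
      _ ≤ |f x| * |g x - g y| + |f x - f y| * |g y| := by
        rw [← abs_mul, ← abs_mul]; exact abs_add_le _ _
      _ ≤ 2 * (A * B) * enorm4 (x - y) := by linarith

lemma isBddLip_comp_apply {φ : ℝ → ℝ} (hφ : ContDiff ℝ 1 φ) (hc : HasCompactSupport φ)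
    (i : Fin 4) : IsBddLip fun x => φ (x i) := by
  obtain ⟨B, hB⟩ := hc.exists_bound_of_continuous hφ.continuous
  obtain ⟨K, hK⟩ := ContDiff.lipschitzWith_of_hasCompactSupport hc hφ one_ne_zero
  refine ⟨max B K, le_max_of_le_right K.2, fun x => (hB _).trans (le_max_left _ _), fun x y => ?_⟩
  have h := hK.dist_le_mul (x i) (y i)
  rw [Real.dist_eq, Real.dist_eq] at h
  exact h.trans (mul_le_mul (le_max_right _ _) (abs_apply_le_enorm4 (x - y) i) (abs_nonneg _)
    (le_max_of_le_right K.2))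

lemma contDiff_mul_sqrt_max {φ : ℝ → ℝ} (hφ : ContDiff ℝ 1 φ) {ε : ℝ} (hε : 0 < ε)
    (h0 : ∀ t < ε, φ t = 0) : ContDiff ℝ 1 fun t => φ t * √(max t 0) := by
  rw [contDiff_iff_contDiffAt]
  intro t
  rcases lt_or_ge t ε with ht | ht
  · refine (contDiffAt_const (c := (0 : ℝ))).congr_of_eventuallyEq ?_
    filter_upwards [Iio_mem_nhds ht] with r hr
    rw [h0 r hr, zero_mul]
  · have ht0 : 0 < t := hε.trans_le ht
    refine (hφ.contDiffAt.mul (contDiffAt_id.sqrt ht0.ne')).congr_of_eventuallyEq ?_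
    filter_upwards [Ioi_mem_nhds ht0] with r hr
    rw [max_eq_left (le_of_lt hr), id]

/-- The linear size `|s| + ∑ⱼ |uⱼ|` of a jump `(s, u)`. -/
def jumpSize (q : ℝ × (Fin 4 → ℝ)) : ℝ := |q.1| + ∑ j, |q.2 j|

lemma jumpSize_nonneg (q : ℝ × (Fin 4 → ℝ)) : 0 ≤ jumpSize q :=
  add_nonneg (abs_nonneg _) (Finset.sum_nonneg fun _ _ => abs_nonneg _)

/-- The coefficient `F q x` is bounded and Lipschitz in `x`, with constants linear in the size of
the jump `q`. -/
def IsJumpLip (F : ℝ × (Fin 4 → ℝ) → (Fin 4 → ℝ) → ℝ) : Prop :=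
  ∃ C : ℝ, (∀ q x, |F q x| ≤ C * jumpSize q) ∧
    ∀ q x y, |F q x - F q y| ≤ C * jumpSize q * enorm4 (x - y)

lemma IsBddLip.isJumpLip_mul {f : (Fin 4 → ℝ) → ℝ} (hf : IsBddLip f)
    {c : ℝ × (Fin 4 → ℝ) → ℝ} (hc : ∀ q, |c q| ≤ jumpSize q) :
    IsJumpLip fun q x => c q * f x := by
  obtain ⟨C, -, hb, hl⟩ := hf
  refine ⟨C, fun q x => ?_, fun q x y => ?_⟩
  · rw [abs_mul, mul_comm C]
    exact mul_le_mul (hc q) (hb x) (abs_nonneg _) (jumpSize_nonneg q)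
  · rw [← mul_sub, abs_mul, mul_comm C, mul_assoc]
    exact mul_le_mul (hc q) (hl x y) (abs_nonneg _) (jumpSize_nonneg q)

lemma IsBddLip.isJumpLip_fst_mul {f : (Fin 4 → ℝ) → ℝ} (hf : IsBddLip f) :
    IsJumpLip fun q x => q.1 * f x :=
  hf.isJumpLip_mul fun _ =>
    le_add_of_nonneg_right (Finset.sum_nonneg fun _ _ => abs_nonneg _)

lemma IsBddLip.isJumpLip_snd_mul {f : (Fin 4 → ℝ) → ℝ} (hf : IsBddLip f) (j : Fin 4) :
    IsJumpLip fun q x => q.2 j * f x :=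
  hf.isJumpLip_mul fun q =>
    (Finset.single_le_sum (f := fun j => |q.2 j|) (fun _ _ => abs_nonneg _)
      (Finset.mem_univ j)).trans (le_add_of_nonneg_left (abs_nonneg _))

lemma IsJumpLip.const_mul {F : ℝ × (Fin 4 → ℝ) → (Fin 4 → ℝ) → ℝ} (hF : IsJumpLip F) (c : ℝ) :
    IsJumpLip fun q x => c * F q x := by
  obtain ⟨C, hb, hl⟩ := hF
  refine ⟨|c| * C, fun q x => ?_, fun q x y => ?_⟩
  · rw [abs_mul, mul_assoc]
    exact mul_le_mul_of_nonneg_left (hb q x) (abs_nonneg c)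
  · rw [← mul_sub, abs_mul, mul_assoc, mul_assoc, ← mul_assoc C]
    exact mul_le_mul_of_nonneg_left (hl q x y) (abs_nonneg c)

lemma IsJumpLip.add {F G : ℝ × (Fin 4 → ℝ) → (Fin 4 → ℝ) → ℝ} (hF : IsJumpLip F)
    (hG : IsJumpLip G) : IsJumpLip fun q x => F q x + G q x := by
  obtain ⟨A, hFb, hFl⟩ := hF
  obtain ⟨B, hGb, hGl⟩ := hG
  refine ⟨A + B, fun q x => ?_, fun q x y => ?_⟩
  · have := abs_add_le (F q x) (G q x)
    linarith [hFb q x, hGb q x]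
  · have := abs_add_le (F q x - F q y) (G q x - G q y)
    rw [add_sub_add_comm]
    linarith [hFl q x y, hGl q x y]

lemma isJumpLip_gFullLoc (θs θv θd θf σv σd σf : ℝ) (H : Matrix (Fin 4) (Fin 4) ℝ) {ψ : ℝ → ℝ}
    (hψ : ContDiff ℝ 1 ψ) (hc : HasCompactSupport ψ) {ε : ℝ} (hε : 0 < ε)
    (h0 : ∀ t < ε, ψ t = 0) (i : Fin 4) :
    IsJumpLip fun q x => gFullLoc θs θv θd θf σv σd σf H ψ q.1 q.2 x i := by
  have hP : ∀ j, IsBddLip fun x => ψ (x j) := isBddLip_comp_apply hψ hc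
  have hX : IsBddLip fun x => ψ (x 0) * x 0 :=
    isBddLip_comp_apply (hψ.mul contDiff_id) hc.mul_right 0
  have hS : ∀ j, IsBddLip fun x => ψ (x j) * √(max (x j) 0) :=
    isBddLip_comp_apply (contDiff_mul_sqrt_max hψ hε h0) hc.mul_right
  have hA := (((hP 0).mul (hP 1)).mul (hP 2)).mul (hP 3)
  fin_cases i
  · have hB := ((hX.mul (hP 1)).mul (hP 2)).mul (hP 3)
    have hD := ((hX.mul (hS 1)).mul (hP 2)).mul (hP 3)
    convert (hB.isJumpLip_fst_mul.const_mul θs).add ((hD.isJumpLip_snd_mul 0).const_mul (H 0 0))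
      using 3
    simp [gFullLoc, gFull, psi5, Fin.prod_univ_four]
    ring
  · have hB := (((hP 0).mul (hS 1)).mul (hP 2)).mul (hP 3)
    convert ((hA.isJumpLip_fst_mul.const_mul θv).add
      ((hB.isJumpLip_snd_mul 0).const_mul (H 1 0 * σv))).add
      ((hB.isJumpLip_snd_mul 1).const_mul (H 1 1 * σv)) using 3
    simp [gFullLoc, gFull, psi5, Fin.prod_univ_four]
    ring
  · have hB := (((hP 0).mul (hP 1)).mul (hS 2)).mul (hP 3)
    convert (((hA.isJumpLip_fst_mul.const_mul θd).add
      ((hB.isJumpLip_snd_mul 0).const_mul (H 2 0 * σd))).add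
      ((hB.isJumpLip_snd_mul 1).const_mul (H 2 1 * σd))).add
      ((hB.isJumpLip_snd_mul 2).const_mul (H 2 2 * σd)) using 3
    simp [gFullLoc, gFull, psi5, Fin.prod_univ_four]
    ring
  · have hB := (((hP 0).mul (hP 1)).mul (hP 2)).mul (hS 3)
    convert ((((hA.isJumpLip_fst_mul.const_mul θf).add
      ((hB.isJumpLip_snd_mul 0).const_mul (H 3 0 * σf))).add
      ((hB.isJumpLip_snd_mul 1).const_mul (H 3 1 * σf))).add
      ((hB.isJumpLip_snd_mul 2).const_mul (H 3 2 * σf))).add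
      ((hB.isJumpLip_snd_mul 3).const_mul (H 3 3 * σf)) using 3
    simp [gFullLoc, gFull, psi5, Fin.prod_univ_four]
    ring

lemma rpow_le_rpow_mul_exp {p r : ℝ} (hp : 0 < p) (hr : 0 ≤ r) : r ^ p ≤ p ^ p * exp r := by
  have h : r ≤ p * exp (r / p) := by
    have := add_one_le_exp (r / p)
    calc r = p * (r / p) := by field_simp
      _ ≤ p * exp (r / p) := by gcongr; linarith
  calc r ^ p ≤ (p * exp (r / p)) ^ p := rpow_le_rpow hr h hp.le
    _ = p ^ p * exp r := by
      rw [mul_rpow hp.le (exp_pos _).le, ← exp_mul, div_mul_cancel₀ _ hp.ne']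

lemma measurable_nu4_density (α β : ℝ) :
    Measurable fun q : ℝ × (Fin 4 → ℝ) => ENNReal.ofReal (gGamma α β q.1 * p4 q.1 q.2) := by
  unfold gGamma p4
  refine (Measurable.mul ?_ ?_).ennreal_ofReal
  · exact Measurable.ite (measurableSet_lt measurable_const measurable_fst) (by fun_prop)
      measurable_const
  · exact Measurable.ite (measurableSet_lt measurable_const measurable_fst) (by fun_prop)
      measurable_const

lemma lintegral_exp_neg_sum_sq {s : ℝ} (hs : 0 < s) :
    ∫⁻ u : Fin 4 → ℝ, ENNReal.ofReal (exp (-(∑ j, u j ^ 2) / (4 * s))) =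
      ENNReal.ofReal ((4 * π * s) ^ 2) := by
  have hb : 0 < 1 / (4 * s) := by positivity
  have hfun : (fun u : Fin 4 → ℝ => exp (-(∑ j, u j ^ 2) / (4 * s))) =
      fun u => ∏ j, exp (-(1 / (4 * s)) * u j ^ 2) := by
    ext u
    rw [← exp_sum, ← Finset.mul_sum]
    congr 1
    ring
  have hint : Integrable (fun u : Fin 4 → ℝ => exp (-(∑ j, u j ^ 2) / (4 * s))) := by
    rw [hfun]
    exact Integrable.fintype_prod (f := fun _ t => exp (-(1 / (4 * s)) * t ^ 2))
      fun _ => integrable_exp_neg_mul_sq hb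
  rw [← ofReal_integral_eq_lintegral_ofReal hint (Filter.Eventually.of_forall fun _ =>
    (exp_pos _).le), hfun,
    integral_fintype_prod_volume_eq_pow fun t : ℝ => exp (-(1 / (4 * s)) * t ^ 2),
    integral_gaussian, Fintype.card_fin, show 4 = 2 * 2 from rfl, pow_mul, sq_sqrt (by positivity)]
  congr 2
  field_simp

lemma lintegral_nu4_lt_top {α β a K : ℝ} (hβ : 0 < β) (ha : 0 < a) (hK : 0 ≤ K)
    {f : ℝ × (Fin 4 → ℝ) → ℝ}
    (hf : ∀ s u, 0 < s → gGamma α β s * p4 s u * f (s, u) ≤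
      K * (s ^ (a - 1) * exp (-β * s)) * (s ^ 2)⁻¹ * exp (-(∑ j, u j ^ 2) / (4 * s))) :
    ∫⁻ q, ENNReal.ofReal (f q) ∂nu4 α β < ⊤ := by
  have hinner : ∀ s : ℝ, ∫⁻ u : Fin 4 → ℝ, ENNReal.ofReal (gGamma α β s * p4 s u) *
      ENNReal.ofReal (f (s, u)) ≤ (Ioi 0).indicator
        (fun s => ENNReal.ofReal (K * (4 * π) ^ 2 * (s ^ (a - 1) * exp (-β * s)))) s := by
    intro s
    by_cases hs : 0 < s
    · rw [indicator_of_mem (mem_Ioi.2 hs)]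
      calc _ ≤ ∫⁻ u : Fin 4 → ℝ, ENNReal.ofReal (K * (s ^ (a - 1) * exp (-β * s)) * (s ^ 2)⁻¹) *
            ENNReal.ofReal (exp (-(∑ j, u j ^ 2) / (4 * s))) := by
            refine lintegral_mono fun u => ?_
            by_cases hg : 0 ≤ gGamma α β s * p4 s u
            · rw [← ENNReal.ofReal_mul hg, ← ENNReal.ofReal_mul (by positivity)]
              exact ENNReal.ofReal_le_ofReal (hf s u hs)
            · simp [ENNReal.ofReal_of_nonpos (not_le.1 hg).le]
        _ = _ := by
            rw [lintegral_const_mul' _ _ ENNReal.ofReal_ne_top, lintegral_exp_neg_sum_sq hs,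
              ← ENNReal.ofReal_mul (by positivity)]
            congr 1
            field_simp
    · rw [indicator_of_notMem (by simpa using hs)]
      simp [gGamma, hs]
  have hint : IntegrableOn (fun s => K * (4 * π) ^ 2 * (s ^ (a - 1) * exp (-β * s))) (Ioi 0) := by
    have := integrableOn_rpow_mul_exp_neg_mul_rpow (s := a - 1) (by linarith) one_pos hβ
    simp only [rpow_one] at this
    exact this.const_mul _
  calc ∫⁻ q, ENNReal.ofReal (f q) ∂nu4 α β
      ≤ ∫⁻ q : ℝ × (Fin 4 → ℝ), ENNReal.ofReal (gGamma α β q.1 * p4 q.1 q.2) *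
          ENNReal.ofReal (f q) :=
        lintegral_withDensity_le_lintegral_mul _ (measurable_nu4_density α β) _
    _ ≤ ∫⁻ s : ℝ, ∫⁻ u : Fin 4 → ℝ, ENNReal.ofReal (gGamma α β s * p4 s u) *
          ENNReal.ofReal (f (s, u)) := lintegral_prod_le _
    _ ≤ _ := lintegral_mono hinner
    _ = _ := lintegral_indicator measurableSet_Ioi _
    _ < ⊤ := hint.lintegral_lt_top

lemma lintegral_abs_fst_rpow_nu4_lt_top {α β p : ℝ} (hα : 0 < α) (hβ : 0 < β) (hp : 0 < p) :
    ∫⁻ q, ENNReal.ofReal (|q.1| ^ p) ∂nu4 α β < ⊤ := by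
  refine lintegral_nu4_lt_top (K := α * ((2 * π) ^ 2)⁻¹) hβ hp (by positivity)
    fun s u hs => ?_
  have hexp : exp (-(∑ j, u j ^ 2) / (2 * s)) ≤ exp (-(∑ j, u j ^ 2) / (4 * s)) := by
    have hS : 0 ≤ ∑ j, u j ^ 2 := Finset.sum_nonneg fun j _ => sq_nonneg _
    rw [exp_le_exp, neg_div, neg_div, neg_le_neg_iff]
    gcongr
    norm_num
  simp only [gGamma, p4, if_pos hs, abs_of_pos hs]
  calc _ = α * ((2 * π) ^ 2)⁻¹ * (s ^ (p - 1) * exp (-β * s)) * (s ^ 2)⁻¹ *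
        exp (-(∑ j, u j ^ 2) / (2 * s)) := by
        rw [rpow_sub_one hs.ne']
        field_simp
    _ ≤ _ := by gcongr

lemma lintegral_abs_snd_rpow_nu4_lt_top {α β p : ℝ} (hα : 0 < α) (hβ : 0 < β) (hp : 0 < p)
    (j : Fin 4) : ∫⁻ q, ENNReal.ofReal (|q.2 j| ^ p) ∂nu4 α β < ⊤ := by
  have hp2 : 0 < p / 2 := by positivity
  refine lintegral_nu4_lt_top (a := p / 2)
    (K := α * ((2 * π) ^ 2)⁻¹ * (4 ^ (p / 2) * (p / 2) ^ (p / 2))) hβ hp2 (by positivity)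
    fun s u hs => ?_
  have hS : u j ^ 2 ≤ ∑ j, u j ^ 2 :=
    Finset.single_le_sum (f := fun j => u j ^ 2) (fun j _ => sq_nonneg _) (Finset.mem_univ j)
  have hS0 : 0 ≤ ∑ j, u j ^ 2 := (sq_nonneg _).trans hS
  have hr := rpow_le_rpow_mul_exp hp2 (show 0 ≤ (∑ j, u j ^ 2) / (4 * s) by positivity)
  have hu : |u j| ^ p ≤ 4 ^ (p / 2) * s ^ (p / 2) *
      ((p / 2) ^ (p / 2) * exp ((∑ j, u j ^ 2) / (4 * s))) := by
    calc |u j| ^ p = (u j ^ 2) ^ (p / 2) := by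
          rw [← sq_abs, ← rpow_natCast, ← rpow_mul (abs_nonneg _)]
          congr 1
          push_cast
          ring
      _ ≤ (∑ j, u j ^ 2) ^ (p / 2) := by gcongr
      _ = (4 * s * ((∑ j, u j ^ 2) / (4 * s))) ^ (p / 2) := by congr 1; field_simp
      _ = 4 ^ (p / 2) * s ^ (p / 2) * ((∑ j, u j ^ 2) / (4 * s)) ^ (p / 2) := by
          rw [mul_rpow (by positivity) (by positivity), mul_rpow (by positivity) hs.le]
      _ ≤ _ := by gcongr
  have hexp : exp (-(∑ j, u j ^ 2) / (2 * s)) * exp ((∑ j, u j ^ 2) / (4 * s)) =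
      exp (-(∑ j, u j ^ 2) / (4 * s)) := by
    rw [← exp_add]
    congr 1
    field_simp
    ring
  simp only [gGamma, p4, if_pos hs]
  refine (mul_le_mul_of_nonneg_left hu (by positivity)).trans_eq ?_
  rw [rpow_sub_one hs.ne', ← hexp]
  field_simp

lemma memLp_nu4_of_lintegral_lt_top {α β p : ℝ} (hp : 0 < p) {f : ℝ × (Fin 4 → ℝ) → ℝ}
    (hf : Measurable f) (h : ∫⁻ q, ENNReal.ofReal (|f q| ^ p) ∂nu4 α β < ⊤) :
    MemLp f (ENNReal.ofReal p) (nu4 α β) := by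
  refine ⟨hf.aestronglyMeasurable, ?_⟩
  rw [eLpNorm_lt_top_iff_lintegral_rpow_enorm_lt_top (by simpa using hp) ENNReal.ofReal_ne_top,
    ENNReal.toReal_ofReal hp.le]
  simpa only [← ofReal_norm, Real.norm_eq_abs,
    ENNReal.ofReal_rpow_of_nonneg (abs_nonneg _) hp.le] using h

lemma lintegral_mul_jumpSize_rpow_nu4_lt_top {α β p : ℝ} (hα : 0 < α) (hβ : 0 < β) (hp : 0 < p)
    (C : ℝ) : ∫⁻ q, ENNReal.ofReal (|C * jumpSize q| ^ p) ∂nu4 α β < ⊤ := by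
  have h1 : MemLp (fun q : ℝ × (Fin 4 → ℝ) => q.1) (ENNReal.ofReal p) (nu4 α β) :=
    memLp_nu4_of_lintegral_lt_top hp measurable_fst (lintegral_abs_fst_rpow_nu4_lt_top hα hβ hp)
  have h2 : ∀ j : Fin 4,
      MemLp (fun q : ℝ × (Fin 4 → ℝ) => q.2 j) (ENNReal.ofReal p) (nu4 α β) := fun j =>
    memLp_nu4_of_lintegral_lt_top hp (by fun_prop) (lintegral_abs_snd_rpow_nu4_lt_top hα hβ hp j)
  have h : MemLp (fun q => C * jumpSize q) (ENNReal.ofReal p) (nu4 α β) :=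
    (h1.abs.add (memLp_finsetSum _ fun j _ => (h2 j).abs)).const_mul C
  have := (eLpNorm_lt_top_iff_lintegral_rpow_enorm_lt_top (by simpa using hp)
    ENNReal.ofReal_ne_top).1 h.2
  rw [ENNReal.toReal_ofReal hp.le] at this
  simpa only [← ofReal_norm, Real.norm_eq_abs,
    ENNReal.ofReal_rpow_of_nonneg (abs_nonneg _) hp.le] using this

/-- Bounds for the localized jump coefficient of the four-factor Heston-CIR system: there exist
`M_n, L_n : ℝ × ℝ⁴ → ℝ` with (i) `|g_n(s,u,x)| ≤ M_n(s,u)`,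
(ii) `|g_n(s,u,x) − g_n(s,u,y)| ≤ L_n(s,u)·|x − y|`, and (iii) all moments
`∫_{ℝ⁵} |M_n|^p dν₄` and `∫_{ℝ⁵} |L_n|^p dν₄` finite for every real `p ≥ 1`. -/
theorem gFullLoc_bounds (α β θs θv θd θf σv σd σf : ℝ)
    (hα : 0 < α) (hβ : 0 < β)
    (hθs : 0 ≤ θs) (hθv : 0 ≤ θv) (hθd : 0 ≤ θd) (hθf : 0 ≤ θf)
    (hσv : 0 < σv) (hσd : 0 < σd) (hσf : 0 < σf)
    (H : Matrix (Fin 4) (Fin 4) ℝ)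
    (n : ℕ) (hn : 1 ≤ n) (ψ : ℝ → ℝ)
    (hψ_smooth : ContDiff ℝ (⊤ : ℕ∞) ψ) (hψ_cpt : HasCompactSupport ψ)
    (hψ_mem : ∀ x, ψ x ∈ Set.Icc (0 : ℝ) 1)
    (hψ_one : ∀ x ∈ Set.Icc (1 / (n : ℝ)) (n : ℝ), ψ x = 1)
    (hψ_supp : Function.support ψ ⊆ Set.Ioo (1 / ((n : ℝ) + 1)) ((n : ℝ) + 1)) :
    ∃ M L : ℝ × (Fin 4 → ℝ) → ℝ,
      (∀ (s : ℝ) (u x : Fin 4 → ℝ),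
        enorm4 (gFullLoc θs θv θd θf σv σd σf H ψ s u x) ≤ M (s, u)) ∧
      (∀ (s : ℝ) (u x y : Fin 4 → ℝ),
        enorm4 (gFullLoc θs θv θd θf σv σd σf H ψ s u x -
            gFullLoc θs θv θd θf σv σd σf H ψ s u y) ≤
          L (s, u) * enorm4 (x - y)) ∧
      (∀ p : ℝ, 1 ≤ p →
        (∫⁻ q : ℝ × (Fin 4 → ℝ), ENNReal.ofReal (|M q| ^ p) ∂nu4 α β) < ⊤ ∧
        (∫⁻ q : ℝ × (Fin 4 → ℝ), ENNReal.ofReal (|L q| ^ p) ∂nu4 α β) < ⊤) := by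
  have hε : 0 < 1 / ((n : ℝ) + 1) := by positivity
  have h0 : ∀ t < 1 / ((n : ℝ) + 1), ψ t = 0 := fun t ht => by
    by_contra h
    exact lt_asymm ht (hψ_supp h).1
  choose C hb hl using
    isJumpLip_gFullLoc θs θv θd θf σv σd σf H (hψ_smooth.of_le (mod_cast le_top)) hψ_cpt hε h0
  refine ⟨fun q => (∑ i, C i) * jumpSize q, fun q => (∑ i, C i) * jumpSize q,
    fun s u x => ?_, fun s u x y => ?_, fun p hp => ?_⟩
  · refine (enorm4_le_sum_abs _).trans ?_
    simp only [Finset.sum_mul]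
    exact Finset.sum_le_sum fun i _ => hb i (s, u) x
  · refine (enorm4_le_sum_abs _).trans ?_
    simp only [Finset.sum_mul]
    exact Finset.sum_le_sum fun i _ => hl i (s, u) x y
  · have h := lintegral_mul_jumpSize_rpow_nu4_lt_top hα hβ (one_pos.trans_le hp) (∑ i, C i)
    exact ⟨h, h⟩
end
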